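/- Under the SONATA setup, suppose ρ < 1/√5 and the parameters satisfy: ξ > 0, γ > (1/(2ξ) + L·w_mx/L_mx²)/(1 − 5ρ²), and 0 < α < min{ 1/(L/2 + ξ/2 + 14·L_mx²·γ·ρ²), √(((1 − 5ρ²)γ − 1/(2ξ))/(2·L·w_mx)) }. Then, as ν → ∞: ‖D^ν‖ → 0, ‖X_⊥^ν‖ → 0, ‖Y_⊥^ν‖ → 0, ∑_{i=1}^m ‖∇f(x_i^ν) − y_i^ν‖² → 0, and both sequences U(X^ν) = ∑_{i=1}^m u(x_i^ν) and U(X^{ν+1/2}) = ∑_{i=1}^m u(x_i^{ν+1/2}) converge to a common real limit ℒ^∞. -/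

import Mathlib

open Filter Topology Finset Matrix

section aux
variable {E : Type*} [NormedAddCommGroup E] [InnerProductSpace ℝ E]

/-- squared distance to consensus -/
noncomputable def perp {m : ℕ} (z : Fin m → E) : ℝ :=
  ∑ i, ‖z i - (m : ℝ)⁻¹ • ∑ j, z j‖ ^ 2

lemma perp_nonneg {m : ℕ} (z : Fin m → E) : 0 ≤ perp z :=
  Finset.sum_nonneg fun _ _ => by positivity

lemma perp_eq {m : ℕ} (hm : 1 ≤ m) (z : Fin m → E) :
    perp z = ∑ i, ‖z i‖ ^ 2 - (m : ℝ)⁻¹ * ‖∑ i, z i‖ ^ 2 := by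
  have hm0 : (m : ℝ) ≠ 0 := by positivity
  unfold perp
  simp_rw [norm_sub_sq_real, Finset.sum_add_distrib, Finset.sum_sub_distrib]
  rw [← Finset.mul_sum, ← sum_inner, inner_smul_right, real_inner_self_eq_norm_sq, norm_smul]
  simp
  field_simp
  ring

lemma perp_le {m : ℕ} (hm : 1 ≤ m) (z : Fin m → E) : perp z ≤ ∑ i, ‖z i‖ ^ 2 := by
  rw [perp_eq hm]
  have : 0 ≤ (m : ℝ)⁻¹ * ‖∑ i, z i‖ ^ 2 := by positivity
  linarith

lemma mean_le {m : ℕ} (hm : 1 ≤ m) (z : Fin m → E) :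
    (m : ℝ)⁻¹ * ‖∑ i, z i‖ ^ 2 ≤ ∑ i, ‖z i‖ ^ 2 := by
  have := perp_eq hm z
  have := perp_nonneg z
  linarith

lemma perp_pair {m : ℕ} (hm : 1 ≤ m) (z : Fin m → E) :
    ∑ i, ∑ j, ‖z i - z j‖ ^ 2 = 2 * m * perp z := by
  have hm0 : (m : ℝ) ≠ 0 := by positivity
  rw [perp_eq hm]
  simp_rw [norm_sub_sq_real, Finset.sum_add_distrib, Finset.sum_sub_distrib, ← Finset.mul_sum,
    ← inner_sum]
  rw [← sum_inner, real_inner_self_eq_norm_sq]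
  simp [← Finset.mul_sum]
  field_simp
  ring

lemma sq_young (a b : E) (s : ℝ) (hs : 0 < s) :
    ‖a + b‖ ^ 2 ≤ (1 + s) * ‖a‖ ^ 2 + (1 + s⁻¹) * ‖b‖ ^ 2 := by
  have h := norm_add_le a b
  have h2 : ‖a + b‖ ^ 2 ≤ (‖a‖ + ‖b‖) ^ 2 := by gcongr
  have h3 : (0:ℝ) ≤ s⁻¹ * (s * ‖a‖ - ‖b‖) ^ 2 := by positivity
  have h4 : s⁻¹ * (s * ‖a‖ - ‖b‖) ^ 2 = s * ‖a‖ ^ 2 - 2 * ‖a‖ * ‖b‖ + s⁻¹ * ‖b‖ ^ 2 := by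
    field_simp
    ring
  nlinarith

lemma perp_add {m : ℕ} (z w : Fin m → E) (s : ℝ) (hs : 0 < s) :
    perp (fun i => z i + w i) ≤ (1 + s) * perp z + (1 + s⁻¹) * perp w := by
  unfold perp
  rw [Finset.mul_sum, Finset.mul_sum, ← Finset.sum_add_distrib]
  refine Finset.sum_le_sum fun i _ => ?_
  have : z i + w i - (m : ℝ)⁻¹ • ∑ j, (z j + w j) =
      (z i - (m : ℝ)⁻¹ • ∑ j, z j) + (w i - (m : ℝ)⁻¹ • ∑ j, w j) := by
    rw [Finset.sum_add_distrib, smul_add]; abel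
  rw [this]
  exact sq_young _ _ s hs

lemma perp_smul {m : ℕ} (z : Fin m → E) (c : ℝ) :
    perp (fun i => c • z i) = c ^ 2 * perp z := by
  unfold perp
  rw [Finset.mul_sum]
  refine Finset.sum_congr rfl fun i _ => ?_
  rw [← Finset.smul_sum, smul_comm, ← smul_sub, norm_smul, mul_pow, Real.norm_eq_abs, sq_abs]

lemma perp_sub {m : ℕ} (z w : Fin m → E) (c : ℝ) :
    perp (fun i => z i - c • w i) ≤ 2 * perp z + 2 * c ^ 2 * perp w := by
  have h := perp_add z (fun i => (-c) • w i) 1 one_pos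
  rw [perp_smul] at h
  have e : (fun i => z i + (-c) • w i) = fun i => z i - c • w i := by
    funext i; rw [neg_smul, sub_eq_add_neg]
  rw [e] at h
  norm_num at h
  linarith

/-- variational characterization of the proximal point -/
lemma prox_var (r : E → ℝ) (hr : ConvexOn ℝ Set.univ r) (α : ℝ) (hα : 0 < α) (v p : E)
    (hp : IsMinOn (fun z => r z + (1 / (2 * α)) * ‖z - v‖ ^ 2) Set.univ p) (z : E) :
    α * (r p - r z) ≤ inner ℝ (p - v) (z - p) := by
  by_contra hcon
  push Not at hcon
  have key : ∀ t : ℝ, 0 < t → t ≤ 1 →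
      α * (r p - r z) ≤ inner ℝ (p - v) (z - p) + t / 2 * ‖z - p‖ ^ 2 := by
    intro t ht ht1
    have h1 := hp (Set.mem_univ (p + t • (z - p)))
    have h2 := hr.2 (Set.mem_univ p) (Set.mem_univ z) (sub_nonneg.2 ht1) ht.le (by ring)
    have e : (1 - t) • p + t • z = p + t • (z - p) := by
      rw [smul_sub, sub_smul, one_smul]; abel
    rw [e] at h2
    simp only [Set.mem_ofPred_eq, smul_eq_mul] at h1 h2
    have e2 : p + t • (z - p) - v = (p - v) + t • (z - p) := by abel
    rw [e2, norm_add_sq_real, inner_smul_right, norm_smul, mul_pow, Real.norm_eq_abs, sq_abs] at h1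
    have h3 : r p ≤ (1 - t) * r p + t * r z
        + 1 / (2 * α) * (2 * (t * inner ℝ (p - v) (z - p)) + t ^ 2 * ‖z - p‖ ^ 2) := by
      linarith
    have h4 : t * (α * (r p - r z)) ≤
        t * (inner ℝ (p - v) (z - p) + t / 2 * ‖z - p‖ ^ 2) := by
      have := mul_le_mul_of_nonneg_left h3 hα.le
      have e3 : α * (1 / (2 * α) * (2 * (t * inner ℝ (p - v) (z - p)) + t ^ 2 * ‖z - p‖ ^ 2))
        = t * (inner ℝ (p - v) (z - p) + t / 2 * ‖z - p‖ ^ 2) := by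
        field_simp
      rw [mul_add, e3] at this
      linarith
    exact le_of_mul_le_mul_left h4 ht
  set δ := α * (r p - r z) - inner ℝ (p - v) (z - p) with hδ
  have hδ0 : 0 < δ := by linarith
  set N := ‖z - p‖ ^ 2
  have hN : 0 ≤ N := by positivity
  have ht : 0 < min 1 (δ / (N + 1)) := by positivity
  have h5 := key _ ht (min_le_left _ _)
  have h6 : min 1 (δ / (N + 1)) ≤ δ / (N + 1) := min_le_right _ _
  have h7 : min 1 (δ / (N + 1)) / 2 * N ≤ δ / (N + 1) / 2 * N := by gcongr
  have h8 : δ / (N + 1) / 2 * N < δ := by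
    rw [div_div, div_mul_eq_mul_div, div_lt_iff₀ (by positivity)]
    nlinarith
  linarith

lemma prox_nonexp (r : E → ℝ) (hr : ConvexOn ℝ Set.univ r) (α : ℝ) (hα : 0 < α) (v p w q : E)
    (hp : IsMinOn (fun z => r z + (1 / (2 * α)) * ‖z - v‖ ^ 2) Set.univ p)
    (hq : IsMinOn (fun z => r z + (1 / (2 * α)) * ‖z - w‖ ^ 2) Set.univ q) :
    ‖p - q‖ ^ 2 ≤ ‖v - w‖ ^ 2 := by
  have h1 := prox_var r hr α hα v p hp q
  have h2 := prox_var r hr α hα w q hq p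
  have h3 : inner ℝ (p - v) (q - p) + inner ℝ (q - w) (p - q)
      = inner ℝ (v - w) (p - q) - ‖p - q‖ ^ 2 := by
    rw [← real_inner_self_eq_norm_sq]
    simp only [inner_sub_left, inner_sub_right]
    ring
  have h4 := real_inner_le_norm (v - w) (p - q)
  nlinarith [sq_nonneg (‖v - w‖ - ‖p - q‖), norm_nonneg (v - w), norm_nonneg (p - q)]

lemma perp_prox {m : ℕ} (hm : 1 ≤ m) (p v : Fin m → E)
    (h : ∀ i j, ‖p i - p j‖ ^ 2 ≤ ‖v i - v j‖ ^ 2) : perp p ≤ perp v := by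
  have h1 : ∑ i, ∑ j, ‖p i - p j‖ ^ 2 ≤ ∑ i, ∑ j, ‖v i - v j‖ ^ 2 :=
    Finset.sum_le_sum fun i _ => Finset.sum_le_sum fun j _ => h i j
  rw [perp_pair hm, perp_pair hm] at h1
  have : (0:ℝ) < 2 * m := by positivity
  exact le_of_mul_le_mul_left h1 this

lemma descent [CompleteSpace E] (f : E → ℝ) (g : E → E) (L : ℝ)
    (hf : ∀ a, HasGradientAt f (g a) a)
    (hg : ∀ a b, ‖g a - g b‖ ≤ L * ‖a - b‖) (a b : E) :
    f b ≤ f a + inner ℝ (g a) (b - a) + L / 2 * ‖b - a‖ ^ 2 := by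
  set v := b - a with hv
  have hd : ∀ t : ℝ, HasDerivAt
      (fun t : ℝ => f (a + t • v) - t * inner ℝ (g a) v - L / 2 * ‖v‖ ^ 2 * t ^ 2)
      (inner ℝ (g (a + t • v)) v - inner ℝ (g a) v - L * ‖v‖ ^ 2 * t) t := by
    intro t
    have h1 : HasDerivAt (fun t : ℝ => a + t • v) v t := by
      simpa using ((hasDerivAt_id t).smul_const v).const_add a
    have h2 := (hf (a + t • v)).hasFDerivAt.comp_hasDerivAt t h1
    have h3 := (h2.sub ((hasDerivAt_id t).mul_const (inner ℝ (g a) v))).sub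
      (((hasDerivAt_id t).pow 2).const_mul (L / 2 * ‖v‖ ^ 2))
    refine h3.congr_deriv ?_
    simp
    ring
  have hanti : AntitoneOn
      (fun t : ℝ => f (a + t • v) - t * inner ℝ (g a) v - L / 2 * ‖v‖ ^ 2 * t ^ 2)
      (Set.Icc 0 1) := by
    apply antitoneOn_of_deriv_nonpos (convex_Icc 0 1)
    · exact fun t _ => (hd t).continuousAt.continuousWithinAt
    · exact fun t _ => (hd t).differentiableAt.differentiableWithinAt
    · intro t ht
      rw [interior_Icc] at ht
      rw [(hd t).deriv, ← inner_sub_left]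
      have h1 := real_inner_le_norm (g (a + t • v) - g a) v
      have h2 := hg (a + t • v) a
      rw [add_sub_cancel_left, norm_smul, Real.norm_eq_abs, abs_of_pos ht.1] at h2
      nlinarith [norm_nonneg v, mul_le_mul_of_nonneg_right h2 (norm_nonneg v)]
  have := hanti (Set.left_mem_Icc.2 zero_le_one) (Set.right_mem_Icc.2 zero_le_one) zero_le_one
  simp only [one_smul, zero_smul, add_zero, hv] at this
  rw [add_sub_cancel] at this
  linarith

lemma descent_lower [CompleteSpace E] (f : E → ℝ) (g : E → E) (L : ℝ)
    (hf : ∀ a, HasGradientAt f (g a) a)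
    (hg : ∀ a b, ‖g a - g b‖ ≤ L * ‖a - b‖) (a b : E) :
    f a + inner ℝ (g a) (b - a) - L / 2 * ‖b - a‖ ^ 2 ≤ f b := by
  have h := descent (fun z => - f z) (fun z => - g z) L
    (fun a => by
      rw [hasGradientAt_iff_hasFDerivAt, map_neg]
      exact (hf a).hasFDerivAt.neg)
    (fun a b => by rw [← neg_sub', norm_neg]; exact hg a b) a b
  rw [inner_neg_left] at h
  linarith

/-- Jensen with defect for smooth plus convex -/
lemma jensen_defect [CompleteSpace E] {m : ℕ} (f r : E → ℝ) (g : E → E) (L : ℝ) (hL : 0 ≤ L)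
    (hf : ∀ a, HasGradientAt f (g a) a)
    (hg : ∀ a b, ‖g a - g b‖ ≤ L * ‖a - b‖) (hr : ConvexOn ℝ Set.univ r)
    (w : Fin m → ℝ) (hw : ∀ j, 0 ≤ w j) (hw1 : ∑ j, w j = 1) (z : Fin m → E) (c : E) :
    f (∑ j, w j • z j) + r (∑ j, w j • z j) ≤
      ∑ j, w j * (f (z j) + r (z j)) + L / 2 * ∑ j, w j * ‖z j - c‖ ^ 2 := by
  set s := ∑ j, w j • z j with hs
  have h1 : r s ≤ ∑ j, w j * r (z j) := by
    have := hr.map_sum_le (t := Finset.univ) (w := w) (p := z) (fun j _ => hw j) hw1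
      (fun _ _ => Set.mem_univ _)
    simpa using this
  have h0 : ∑ j, w j • (z j - s) = 0 := by
    simp_rw [smul_sub, Finset.sum_sub_distrib]
    rw [← Finset.sum_smul, hw1, one_smul, ← hs, sub_self]
  have h2 : ∑ j, w j * (f s + inner ℝ (g s) (z j - s) - L / 2 * ‖z j - s‖ ^ 2)
      ≤ ∑ j, w j * f (z j) :=
    Finset.sum_le_sum fun j _ =>
      mul_le_mul_of_nonneg_left (descent_lower f g L hf hg s (z j)) (hw j)
  have h3 : ∑ j, w j * (f s + inner ℝ (g s) (z j - s) - L / 2 * ‖z j - s‖ ^ 2)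
      = f s - L / 2 * ∑ j, w j * ‖z j - s‖ ^ 2 := by
    have e : ∑ j, w j * inner ℝ (g s) (z j - s) = 0 := by
      simp_rw [← inner_smul_right]
      rw [← inner_sum, h0, inner_zero_right]
    simp_rw [mul_sub, mul_add, Finset.sum_sub_distrib, Finset.sum_add_distrib]
    rw [← Finset.sum_mul, hw1, e, Finset.mul_sum]
    have : ∀ j, w j * (L / 2 * ‖z j - s‖ ^ 2) = L / 2 * (w j * ‖z j - s‖ ^ 2) := fun j => by ring
    simp_rw [this]
    ring
  have h4 : ∑ j, w j * ‖z j - s‖ ^ 2 ≤ ∑ j, w j * ‖z j - c‖ ^ 2 := by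
    have e : ∀ j, w j * ‖z j - c‖ ^ 2 = w j * ‖z j - s‖ ^ 2
        + 2 * inner ℝ (w j • (z j - s)) (s - c) + w j * ‖s - c‖ ^ 2 := by
      intro j
      have : z j - c = (z j - s) + (s - c) := by abel
      rw [this, norm_add_sq_real, inner_smul_left]
      simp
      ring
    simp_rw [e, Finset.sum_add_distrib]
    rw [← Finset.mul_sum, ← sum_inner, h0, inner_zero_left, ← Finset.sum_mul, hw1]
    nlinarith [sq_nonneg ‖s - c‖]
  have h5 : ∑ j, w j * (f (z j) + r (z j)) = ∑ j, w j * f (z j) + ∑ j, w j * r (z j) := by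
    simp_rw [mul_add, Finset.sum_add_distrib]
  rw [h5]
  have h6 : L / 2 * ∑ j, w j * ‖z j - s‖ ^ 2 ≤ L / 2 * ∑ j, w j * ‖z j - c‖ ^ 2 := by gcongr
  linarith

end aux

lemma op_bound {d m : ℕ} (A : Matrix (Fin m) (Fin m) ℝ) (z : Fin m → EuclideanSpace ℝ (Fin d)) :
    ∑ i, ‖∑ j, A i j • z j‖ ^ 2 ≤
      ‖Matrix.toEuclideanCLM (𝕜 := ℝ) (n := Fin m) A‖ ^ 2 * ∑ i, ‖z i‖ ^ 2 := by
  simp_rw [EuclideanSpace.real_norm_sq_eq]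
  rw [Finset.sum_comm, Finset.sum_comm (f := fun i k => (z i k) ^ 2), Finset.mul_sum]
  refine Finset.sum_le_sum fun k _ => ?_
  have h := (Matrix.toEuclideanCLM (𝕜 := ℝ) (n := Fin m) A).le_opNorm
    (WithLp.toLp 2 fun j => z j k)
  have h2 := pow_le_pow_left₀ (norm_nonneg _) h 2
  rw [mul_pow, EuclideanSpace.real_norm_sq_eq, EuclideanSpace.real_norm_sq_eq] at h2
  convert h2 using 3 with i
  simp [Matrix.mulVec, dotProduct]

lemma sum_mix {E : Type*} [NormedAddCommGroup E] [InnerProductSpace ℝ E] {m : ℕ}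
    (W : Matrix (Fin m) (Fin m) ℝ)
    (hWcol : ∀ j, ∑ i, W i j = 1) (z : Fin m → E) :
    ∑ i, ∑ j, W i j • z j = ∑ j, z j := by
  rw [Finset.sum_comm]
  refine Finset.sum_congr rfl fun j _ => ?_
  rw [← Finset.sum_smul, hWcol, one_smul]

lemma perp_mix {d m : ℕ} (hm : 1 ≤ m) (W : Matrix (Fin m) (Fin m) ℝ)
    (hWrow : ∀ i, ∑ j, W i j = 1) (hWcol : ∀ j, ∑ i, W i j = 1)
    (z : Fin m → EuclideanSpace ℝ (Fin d)) :
    perp (fun i => ∑ j, W i j • z j) ≤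
      ‖Matrix.toEuclideanCLM (𝕜 := ℝ) (n := Fin m)
        (W - (m : ℝ)⁻¹ • Matrix.of fun _ _ => (1 : ℝ))‖ ^ 2 * perp z := by
  have hm0 : (m : ℝ) ≠ 0 := by positivity
  have h := op_bound (W - (m : ℝ)⁻¹ • Matrix.of fun _ _ => (1 : ℝ))
    (fun i => z i - (m : ℝ)⁻¹ • ∑ j, z j)
  refine le_trans (le_of_eq ?_) h
  unfold perp
  refine Finset.sum_congr rfl fun i _ => ?_
  congr 2
  rw [sum_mix W hWcol]
  simp only [Matrix.sub_apply, Matrix.smul_apply, Matrix.of_apply, smul_eq_mul, mul_one, sub_smul,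
    smul_sub, Finset.sum_sub_distrib]
  rw [← Finset.sum_smul, hWrow, one_smul, ← Finset.smul_sum]
  simp only [Finset.sum_const, Finset.card_univ, Fintype.card_fin]
  rw [← Nat.cast_smul_eq_nsmul ℝ, smul_smul, smul_smul]
  have : (m : ℝ) * (m : ℝ)⁻¹ * (m : ℝ)⁻¹ = (m : ℝ)⁻¹ := by field_simp
  rw [this]
  abel

lemma avg_grad {d m : ℕ} (f : Fin m → EuclideanSpace ℝ (Fin d) → ℝ)
    (hdiff : ∀ i, Differentiable ℝ (f i)) (a : EuclideanSpace ℝ (Fin d)) :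
    HasGradientAt (fun z => (∑ i, f i z) / m) ((m : ℝ)⁻¹ • ∑ i, gradient (f i) a) a := by
  rw [hasGradientAt_iff_hasFDerivAt, map_smul, map_sum]
  have h : HasFDerivAt (fun z => ∑ i, f i z)
      (∑ i, (InnerProductSpace.toDual ℝ _) (gradient (f i) a)) a :=
    HasFDerivAt.fun_sum fun i _ => ((hdiff i a).hasGradientAt).hasFDerivAt
  have h2 := h.const_mul ((m : ℝ)⁻¹)
  refine h2.congr_of_eventuallyEq (Filter.Eventually.of_forall fun z => ?_)
  simp only [div_eq_inv_mul]

lemma avg_lip {d m : ℕ} (G : Fin m → EuclideanSpace ℝ (Fin d) → EuclideanSpace ℝ (Fin d))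
    (Lf : Fin m → ℝ)
    (hlip : ∀ i, ∀ a b, ‖G i a - G i b‖ ≤ Lf i * ‖a - b‖) (a b : EuclideanSpace ℝ (Fin d)) :
    ‖(m : ℝ)⁻¹ • ∑ i, G i a - (m : ℝ)⁻¹ • ∑ i, G i b‖ ≤ (∑ i, Lf i) / m * ‖a - b‖ := by
  rw [← smul_sub, ← Finset.sum_sub_distrib, norm_smul, norm_inv, Real.norm_natCast]
  have h : ‖∑ i, (G i a - G i b)‖ ≤ (∑ i, Lf i) * ‖a - b‖ := by
    rw [Finset.sum_mul]
    exact norm_sum_le_of_le _ fun i _ => hlip i a b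
  calc (m : ℝ)⁻¹ * ‖∑ i, (G i a - G i b)‖ ≤ (m : ℝ)⁻¹ * ((∑ i, Lf i) * ‖a - b‖) := by gcongr
    _ = _ := by ring

/-- the tracking error bound -/
lemma track_err {d m : ℕ} (hm : 1 ≤ m)
    (G : Fin m → EuclideanSpace ℝ (Fin d) → EuclideanSpace ℝ (Fin d)) (M : ℝ) (hM : 0 ≤ M)
    (hlip : ∀ i, ∀ a b, ‖G i a - G i b‖ ≤ M * ‖a - b‖)
    (x y : Fin m → EuclideanSpace ℝ (Fin d)) (hy : ∑ i, y i = ∑ i, G i (x i)) :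
    ∑ i, ‖(m : ℝ)⁻¹ • ∑ j, G j (x i) - y i‖ ^ 2 ≤ 4 * M ^ 2 * perp x + 2 * perp y := by
  have hm0 : (0 : ℝ) < m := by positivity
  have h1 : ∀ i, ‖(m : ℝ)⁻¹ • ∑ j, G j (x i) - y i‖ ^ 2 ≤
      2 * ((m : ℝ)⁻¹ * ∑ j, M ^ 2 * ‖x i - x j‖ ^ 2)
        + 2 * ‖y i - (m : ℝ)⁻¹ • ∑ j, y j‖ ^ 2 := by
    intro i
    have e : (m : ℝ)⁻¹ • ∑ j, G j (x i) - y i =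
        (m : ℝ)⁻¹ • ∑ j, (G j (x i) - G j (x j)) + ((m : ℝ)⁻¹ • ∑ j, y j - y i) := by
      rw [hy, Finset.sum_sub_distrib, smul_sub]; abel
    have h := sq_young ((m : ℝ)⁻¹ • ∑ j, (G j (x i) - G j (x j)))
      ((m : ℝ)⁻¹ • ∑ j, y j - y i) 1 one_pos
    rw [← e, norm_sub_rev ((m : ℝ)⁻¹ • ∑ j, y j) (y i), inv_one, one_add_one_eq_two] at h
    have h2 := mean_le hm (fun j => G j (x i) - G j (x j))
    have h3 : ∑ j, ‖G j (x i) - G j (x j)‖ ^ 2 ≤ ∑ j, M ^ 2 * ‖x i - x j‖ ^ 2 := by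
      refine Finset.sum_le_sum fun j _ => ?_
      rw [← mul_pow]
      exact pow_le_pow_left₀ (norm_nonneg _) (hlip j _ _) 2
    have h4 : ‖(m : ℝ)⁻¹ • ∑ j, (G j (x i) - G j (x j))‖ ^ 2 ≤
        (m : ℝ)⁻¹ * ∑ j, M ^ 2 * ‖x i - x j‖ ^ 2 := by
      rw [norm_smul, norm_inv, Real.norm_natCast, mul_pow, pow_two (m : ℝ)⁻¹, mul_assoc]
      have := h2.trans h3
      gcongr
    linarith
  refine (Finset.sum_le_sum fun i _ => h1 i).trans (le_of_eq ?_)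
  rw [Finset.sum_add_distrib, ← Finset.mul_sum, ← Finset.mul_sum, ← Finset.mul_sum]
  simp_rw [← Finset.mul_sum]
  rw [perp_pair hm]
  unfold perp
  field_simp
  ring

/-- Abstract convergence argument. -/
lemma lyap_conv (U Uh X Y D : ℕ → ℝ) (B a b c e g p q : ℝ)
    (ha : 0 < a) (hb : 0 < b) (hc : 0 < c)
    (hX : ∀ n, 0 ≤ X n) (hY : ∀ n, 0 ≤ Y n) (hD : ∀ n, 0 ≤ D n)
    (he : 0 ≤ e) (hg : 0 ≤ g)
    (hB : ∀ n, B ≤ U n)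
    (hV : ∀ n, U (n + 1) + (e * X (n + 1) + g * Y (n + 1)) + (a * X n + b * Y n + c * D n)
      ≤ U n + (e * X n + g * Y n))
    (h1 : ∀ n, Uh n ≤ U n + p * (e * X n + g * Y n))
    (h2 : ∀ n, U (n + 1) ≤ Uh n + q * (X n + Y n)) (hq : 0 ≤ q) :
    Tendsto X atTop (𝓝 0) ∧ Tendsto Y atTop (𝓝 0) ∧ Tendsto D atTop (𝓝 0) ∧
    ∃ l, Tendsto U atTop (𝓝 l) ∧ Tendsto Uh atTop (𝓝 l) := by
  set V : ℕ → ℝ := fun n => U n + (e * X n + g * Y n) with hVdef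
  have hVn : ∀ n, V (n + 1) + (a * X n + b * Y n + c * D n) ≤ V n := hV
  have haX : ∀ n, 0 ≤ a * X n := fun n => mul_nonneg ha.le (hX n)
  have hbY : ∀ n, 0 ≤ b * Y n := fun n => mul_nonneg hb.le (hY n)
  have hcD : ∀ n, 0 ≤ c * D n := fun n => mul_nonneg hc.le (hD n)
  have hanti : Antitone V := antitone_nat_of_succ_le fun n => by
    linarith [hVn n, haX n, hbY n, hcD n]
  have hbd : ∀ n, B ≤ V n := fun n => by
    have := hB n
    have := mul_nonneg he (hX n)
    have := mul_nonneg hg (hY n)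
    simp only [hVdef]; linarith
  have hlim := tendsto_atTop_ciInf hanti ⟨B, by rintro _ ⟨n, rfl⟩; exact hbd n⟩
  set l := ⨅ n, V n
  have hdiff : Tendsto (fun n => V n - V (n + 1)) atTop (𝓝 0) := by
    simpa using hlim.sub (hlim.comp (tendsto_add_atTop_nat 1))
  have gen : ∀ (Z : ℕ → ℝ) (k : ℝ), 0 < k → (∀ n, 0 ≤ Z n) →
      (∀ n, k * Z n ≤ V n - V (n + 1)) → Tendsto Z atTop (𝓝 0) := by
    intro Z k hk hZ hle
    have h3 : Tendsto (fun n => k⁻¹ * (V n - V (n + 1))) atTop (𝓝 0) := by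
      simpa using hdiff.const_mul k⁻¹
    refine squeeze_zero hZ (fun n => ?_) h3
    rw [← div_eq_inv_mul, le_div_iff₀ hk, mul_comm]
    exact hle n
  have tX := gen X a ha hX fun n => by linarith [hVn n, haX n, hbY n, hcD n]
  have tY := gen Y b hb hY fun n => by linarith [hVn n, haX n, hbY n, hcD n]
  have tD := gen D c hc hD fun n => by linarith [hVn n, haX n, hbY n, hcD n]
  have tG : Tendsto (fun n => e * X n + g * Y n) atTop (𝓝 0) := by
    simpa using (tX.const_mul e).add (tY.const_mul g)
  have tU : Tendsto U atTop (𝓝 l) := by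
    have := hlim.sub tG
    simpa [hVdef] using this
  refine ⟨tX, tY, tD, l, tU, ?_⟩
  have lo : Tendsto (fun n => U (n + 1) - q * (X n + Y n)) atTop (𝓝 l) := by
    simpa using (tU.comp (tendsto_add_atTop_nat 1)).sub ((tX.add tY).const_mul q)
  have hi : Tendsto (fun n => U n + p * (e * X n + g * Y n)) atTop (𝓝 l) := by
    simpa using tU.add (tG.const_mul p)
  exact tendsto_of_tendsto_of_tendsto_of_le_of_le lo hi
    (fun n => by have := h2 n; simp only; linarith) h1

set_option maxHeartbeats 2000000 in
theorem stmt0 (d m : ℕ) (hd : 1 ≤ d) (hm : 1 ≤ m)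
    (f : Fin m → EuclideanSpace ℝ (Fin d) → ℝ) (Lf : Fin m → ℝ)
    (hdiff : ∀ i, Differentiable ℝ (f i))
    (hlip : ∀ i, ∀ a b : EuclideanSpace ℝ (Fin d),
      ‖gradient (f i) a - gradient (f i) b‖ ≤ Lf i * ‖a - b‖)
    (L Lmx : ℝ) (hL : L = (∑ i, Lf i) / m)
    (hLmx : Lmx = Finset.univ.sup' ⟨⟨0, hm⟩, Finset.mem_univ _⟩ Lf)
    (favg : EuclideanSpace ℝ (Fin d) → ℝ) (hfavg : favg = fun z => (∑ i, f i z) / m)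
    (r : EuclideanSpace ℝ (Fin d) → ℝ) (hr : ConvexOn ℝ Set.univ r)
    (u : EuclideanSpace ℝ (Fin d) → ℝ) (hu : u = fun z => favg z + r z)
    (hbdd : ∃ b : ℝ, ∀ z, b ≤ u z)
    (W : Matrix (Fin m) (Fin m) ℝ)
    (hWdiag : ∀ i, 0 < W i i) (hWnn : ∀ i j, 0 ≤ W i j)
    (hWrow : ∀ i, ∑ j, W i j = 1) (hWcol : ∀ j, ∑ i, W i j = 1)
    (wmx : ℝ)
    (hwmx : wmx = ∑ i, Finset.univ.sup' ⟨⟨0, hm⟩, Finset.mem_univ _⟩ (fun j => W i j))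
    (ρ : ℝ)
    (hρ : ρ = ‖Matrix.toEuclideanCLM (𝕜 := ℝ) (n := Fin m)
      (W - (m : ℝ)⁻¹ • Matrix.of fun _ _ => (1 : ℝ))‖)
    (α : ℝ) (hα : 0 < α)
    (x xh y : ℕ → Fin m → EuclideanSpace ℝ (Fin d))
    (hprox : ∀ ν i, IsMinOn
      (fun z => r z + (1 / (2 * α)) * ‖z - (x ν i - α • y ν i)‖ ^ 2) Set.univ (xh ν i))
    (hxupd : ∀ ν i, x (ν + 1) i = ∑ j, W i j • xh ν j)
    (hyupd : ∀ ν i, y (ν + 1) i = ∑ j, W i j •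
      (y ν j + gradient (f j) (x (ν + 1) j) - gradient (f j) (x ν j)))
    (hy0 : ∀ i, y 0 i = gradient (f i) (x 0 i))
    (hρ5 : ρ < 1 / Real.sqrt 5)
    (ξ γ : ℝ) (hξ : 0 < ξ)
    (hγ : (1 / (2 * ξ) + L * wmx / Lmx ^ 2) / (1 - 5 * ρ ^ 2) < γ)
    (hα1 : α < 1 / (L / 2 + ξ / 2 + 14 * Lmx ^ 2 * γ * ρ ^ 2))
    (hα2 : α < Real.sqrt (((1 - 5 * ρ ^ 2) * γ - 1 / (2 * ξ)) / (2 * L * wmx))) :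
    Tendsto (fun ν => Real.sqrt (∑ i, ‖xh ν i - x ν i‖ ^ 2)) atTop (𝓝 0) ∧
    Tendsto (fun ν => Real.sqrt (∑ i, ‖x ν i - (m : ℝ)⁻¹ • ∑ j, x ν j‖ ^ 2)) atTop (𝓝 0) ∧
    Tendsto (fun ν => Real.sqrt (∑ i, ‖y ν i - (m : ℝ)⁻¹ • ∑ j, y ν j‖ ^ 2)) atTop (𝓝 0) ∧
    Tendsto (fun ν => ∑ i, ‖gradient favg (x ν i) - y ν i‖ ^ 2) atTop (𝓝 0) ∧
    ∃ Linf : ℝ,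
      Tendsto (fun ν => ∑ i, u (x ν i)) atTop (𝓝 Linf) ∧
      Tendsto (fun ν => ∑ i, u (xh ν i)) atTop (𝓝 Linf) := by
  have hm0 : (0 : ℝ) < m := by positivity
  -- positivity of the Lipschitz constants
  have hLf : ∀ i, 0 ≤ Lf i := by
    intro i
    have h := hlip i (EuclideanSpace.single ⟨0, hd⟩ 1) 0
    have h2 : ‖(EuclideanSpace.single (⟨0, hd⟩ : Fin d) (1 : ℝ)) - 0‖ = 1 := by simp
    rw [h2, mul_one] at h
    exact (norm_nonneg _).trans h
  have hL0 : 0 ≤ L := by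
    rw [hL]; exact div_nonneg (Finset.sum_nonneg fun i _ => hLf i) hm0.le
  have hLne : L ≠ 0 := by
    intro h0
    rw [h0] at hα2
    simp at hα2
    linarith
  have hLpos : 0 < L := lt_of_le_of_ne hL0 (Ne.symm hLne)
  have hle : ∀ i, Lf i ≤ Lmx := by
    intro i
    rw [hLmx]; exact Finset.le_sup' Lf (Finset.mem_univ i)
  have hLmxpos : 0 < Lmx := by
    have : L ≤ Lmx := by
      rw [hL, div_le_iff₀ hm0]
      calc ∑ i, Lf i ≤ ∑ _i : Fin m, Lmx := Finset.sum_le_sum fun i _ => hle i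
        _ = _ := by simp [mul_comm]
    linarith
  have hw1 : 1 ≤ wmx := by
    rw [hwmx, ← hWcol ⟨0, hm⟩]
    exact Finset.sum_le_sum fun i _ =>
      Finset.le_sup' (fun j => W i j) (Finset.mem_univ (⟨0, hm⟩ : Fin m))
  -- parameters
  have hρ0 : 0 ≤ ρ := by rw [hρ]; exact norm_nonneg _
  have hρ2 : 5 * ρ ^ 2 < 1 := by
    have h5 : (0 : ℝ) < Real.sqrt 5 := by positivity
    rw [lt_div_iff₀ h5] at hρ5
    have h := pow_lt_pow_left₀ hρ5 (by positivity) (two_ne_zero)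
    rw [mul_pow, Real.sq_sqrt (by norm_num)] at h
    linarith
  have hκ : 0 < 1 - 5 * ρ ^ 2 := by linarith
  rw [div_lt_iff₀ hκ] at hγ
  set β : ℝ := (1 - 5 * ρ ^ 2) * γ - 1 / (2 * ξ) with hβ
  have hξ' : 0 < 1 / (2 * ξ) := by positivity
  have hLw : 0 < L * wmx := by positivity
  have hβ1 : L * wmx < β * Lmx ^ 2 := by
    rw [← div_lt_iff₀ (by positivity)]
    rw [hβ]; linarith
  have hβpos : 0 < β := by
    have : 0 < β * Lmx ^ 2 := hLw.trans hβ1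
    exact pos_of_mul_pos_left this (by positivity)
  have hγpos : 0 < γ := by
    have : 0 < γ * (1 - 5 * ρ ^ 2) := by linarith
    exact pos_of_mul_pos_left this hκ.le
  have hβ2 : 2 * L * wmx * α ^ 2 < β := by
    have h := (Real.lt_sqrt hα.le).1 hα2
    rw [lt_div_iff₀ (by positivity)] at h
    linarith
  have hLLw : L ≤ L * wmx := by nlinarith
  have ca : 0 < 4 * Lmx ^ 2 * β - L := by nlinarith
  have cb : 0 < 2 * β - L * α ^ 2 := by
    have : L * α ^ 2 ≤ L * wmx * α ^ 2 := by gcongr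
    nlinarith
  have cc : 0 < 1 / α - (L / 2 + ξ / 2 + 14 * Lmx ^ 2 * γ * ρ ^ 2) := by
    have hpos : 0 < L / 2 + ξ / 2 + 14 * Lmx ^ 2 * γ * ρ ^ 2 := by positivity
    rw [sub_pos, lt_div_iff₀ hα]
    rw [lt_div_iff₀ hpos] at hα1
    linarith
  -- gradient of the average
  set g : EuclideanSpace ℝ (Fin d) → EuclideanSpace ℝ (Fin d) :=
    fun a => (m : ℝ)⁻¹ • ∑ i, gradient (f i) a with hgdef
  have hg : ∀ a, HasGradientAt favg (g a) a := fun a => by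
    rw [hfavg]; exact avg_grad f hdiff a
  have hgrad : gradient favg = g := funext fun a => (hg a).gradient
  have hglip : ∀ a b, ‖g a - g b‖ ≤ L * ‖a - b‖ := fun a b => by
    rw [hL]; exact avg_lip (fun i => gradient (f i)) Lf hlip a b
  have hlipM : ∀ i, ∀ a b : EuclideanSpace ℝ (Fin d),
      ‖gradient (f i) a - gradient (f i) b‖ ≤ Lmx * ‖a - b‖ := fun i a b =>
    (hlip i a b).trans (by gcongr; exact hle i)
  -- tracking invariant
  have hmean : ∀ ν, ∑ i, y ν i = ∑ i, gradient (f i) (x ν i) := by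
    intro ν
    induction ν with
    | zero => exact Finset.sum_congr rfl fun i _ => hy0 i
    | succ k ih =>
      simp_rw [hyupd]
      rw [sum_mix W hWcol, Finset.sum_sub_distrib, Finset.sum_add_distrib, ih]
      abel
  have herr : ∀ ν, ∑ i, ‖g (x ν i) - y ν i‖ ^ 2 ≤
      4 * Lmx ^ 2 * perp (x ν) + 2 * perp (y ν) := fun ν =>
    track_err hm (fun i => gradient (f i)) Lmx hLmxpos.le hlipM (x ν) (y ν) (hmean ν)
  -- half-step descent
  have hhalf : ∀ ν, ∑ i, u (xh ν i) ≤ ∑ i, u (x ν i)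
      + 1 / (2 * ξ) * (4 * Lmx ^ 2 * perp (x ν) + 2 * perp (y ν))
      - (1 / α - L / 2 - ξ / 2) * ∑ i, ‖xh ν i - x ν i‖ ^ 2 := by
    intro ν
    have hi : ∀ i, u (xh ν i) ≤ u (x ν i) + 1 / (2 * ξ) * ‖g (x ν i) - y ν i‖ ^ 2
        - (1 / α - L / 2 - ξ / 2) * ‖xh ν i - x ν i‖ ^ 2 := by
      intro i
      have h1 := prox_var r hr α hα _ _ (hprox ν i) (x ν i)
      have h2 := descent favg g L hg hglip (x ν i) (xh ν i)
      set δ := xh ν i - x ν i with hδ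
      have e1 : xh ν i - (x ν i - α • y ν i) = δ + α • y ν i := by rw [hδ]; abel
      have e2 : x ν i - xh ν i = -δ := by rw [hδ]; abel
      rw [e1, e2, inner_neg_right, inner_add_left, inner_smul_left,
        real_inner_self_eq_norm_sq] at h1
      simp only [conj_trivial] at h1
      have h3 : r (xh ν i) - r (x ν i) ≤ - (1 / α * ‖δ‖ ^ 2) - inner ℝ (y ν i) δ := by
        have : α * (r (xh ν i) - r (x ν i)) ≤
            α * (- (1 / α * ‖δ‖ ^ 2) - inner ℝ (y ν i) δ) := by
          refine h1.trans (le_of_eq ?_)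
          field_simp
          ring
        exact le_of_mul_le_mul_left this hα
      have h4 : inner ℝ (g (x ν i)) δ - inner ℝ (y ν i) δ ≤
          1 / (2 * ξ) * ‖g (x ν i) - y ν i‖ ^ 2 + ξ / 2 * ‖δ‖ ^ 2 := by
        rw [← inner_sub_left]
        refine (real_inner_le_norm _ _).trans ?_
        have h5 : 0 ≤ 1 / (2 * ξ) * (‖g (x ν i) - y ν i‖ - ξ * ‖δ‖) ^ 2 := by positivity
        have h6 : 1 / (2 * ξ) * (‖g (x ν i) - y ν i‖ - ξ * ‖δ‖) ^ 2 =
            1 / (2 * ξ) * ‖g (x ν i) - y ν i‖ ^ 2 + ξ / 2 * ‖δ‖ ^ 2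
              - ‖g (x ν i) - y ν i‖ * ‖δ‖ := by
          field_simp
          ring
        linarith
      simp only [hu]
      linarith
    have h7 := Finset.sum_le_sum fun i (_ : i ∈ Finset.univ) => hi i
    rw [Finset.sum_sub_distrib, Finset.sum_add_distrib, ← Finset.mul_sum, ← Finset.mul_sum] at h7
    have h8 := mul_le_mul_of_nonneg_left (herr ν) hξ'.le
    linarith
  -- consensus of the half step
  have hxh : ∀ ν, perp (xh ν) ≤ 2 * perp (x ν) + 2 * α ^ 2 * perp (y ν) := fun ν =>
    (perp_prox hm (xh ν) (fun i => x ν i - α • y ν i) fun i j =>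
      prox_nonexp r hr α hα _ _ _ _ (hprox ν i) (hprox ν j)).trans (perp_sub (x ν) (y ν) α)
  -- mixing step
  have hmix : ∀ ν, ∑ i, u (x (ν + 1) i) ≤ ∑ i, u (xh ν i)
      + (L * perp (x ν) + L * α ^ 2 * perp (y ν)) := by
    intro ν
    have hi : ∀ i, u (x (ν + 1) i) ≤ ∑ j, W i j * u (xh ν j)
        + L / 2 * ∑ j, W i j * ‖xh ν j - (m : ℝ)⁻¹ • ∑ k, xh ν k‖ ^ 2 := by
      intro i
      rw [hxupd]
      simp only [hu]
      exact jensen_defect favg r g L hL0 hg hglip hr (fun j => W i j) (hWnn i) (hWrow i) (xh ν) _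
    have h1 := Finset.sum_le_sum fun i (_ : i ∈ Finset.univ) => hi i
    have sw : ∀ c : Fin m → ℝ, ∑ i, ∑ j, W i j * c j = ∑ j, c j := fun c => by
      rw [Finset.sum_comm]
      refine Finset.sum_congr rfl fun j _ => ?_
      rw [← Finset.sum_mul, hWcol, one_mul]
    rw [Finset.sum_add_distrib, ← Finset.mul_sum, sw, sw] at h1
    have h2 : L / 2 * perp (xh ν) ≤ L / 2 * (2 * perp (x ν) + 2 * α ^ 2 * perp (y ν)) := by
      gcongr; exact hxh ν
    unfold perp at h2 ⊢
    linarith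
  -- contraction of the consensus errors
  have hX1 : ∀ ν, perp (x (ν + 1)) ≤
      ρ ^ 2 * (2 * perp (x ν) + 2 * ∑ i, ‖xh ν i - x ν i‖ ^ 2) := by
    intro ν
    have h1 := perp_mix hm W hWrow hWcol (xh ν)
    rw [← hρ, ← (funext fun i => hxupd ν i : x (ν + 1) = fun i => ∑ j, W i j • xh ν j)] at h1
    have h2 := perp_add (x ν) (fun i => xh ν i - x ν i) 1 one_pos
    simp only [add_sub_cancel] at h2
    norm_num at h2
    have h3 := perp_le hm (fun i => xh ν i - x ν i)
    refine h1.trans ?_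
    gcongr
    have h2' : perp (xh ν) ≤ 2 * perp (x ν) + 2 * perp (fun i => xh ν i - x ν i) := h2
    linarith
  have hQ : ∀ ν, ∑ i, ‖x (ν + 1) i - x ν i‖ ^ 2 ≤
      2 * perp (x (ν + 1)) + 2 * perp (x ν) + ∑ i, ‖xh ν i - x ν i‖ ^ 2 := by
    intro ν
    have h1 := perp_eq hm (fun i => x (ν + 1) i - x ν i)
    have h2 := perp_sub (x (ν + 1)) (x ν) 1
    simp only [one_smul] at h2
    have h3 := mean_le hm (fun i => xh ν i - x ν i)
    have e : ∑ i, (x (ν + 1) i - x ν i) = ∑ i, (xh ν i - x ν i) := by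
      rw [Finset.sum_sub_distrib, Finset.sum_sub_distrib]
      simp_rw [hxupd]
      rw [sum_mix W hWcol]
    rw [e] at h1
    linarith
  have hY1 : ∀ ν, perp (y (ν + 1)) ≤
      ρ ^ 2 * (5 * perp (y ν) + 5 / 4 * (Lmx ^ 2 * ∑ i, ‖x (ν + 1) i - x ν i‖ ^ 2)) := by
    intro ν
    set Δ : Fin m → EuclideanSpace ℝ (Fin d) :=
      fun j => gradient (f j) (x (ν + 1) j) - gradient (f j) (x ν j) with hΔ
    have hyΔ : y (ν + 1) = fun i => ∑ j, W i j • (y ν j + Δ j) := funext fun i => by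
      rw [hyupd]
      refine Finset.sum_congr rfl fun j _ => ?_
      rw [hΔ, add_sub_assoc]
    have h1 := perp_mix hm W hWrow hWcol (fun j => y ν j + Δ j)
    rw [← hρ, ← hyΔ] at h1
    have h2 := perp_add (y ν) Δ 4 (by norm_num)
    norm_num at h2
    have h3 := perp_le hm Δ
    have h4 : ∑ i, ‖Δ i‖ ^ 2 ≤ Lmx ^ 2 * ∑ i, ‖x (ν + 1) i - x ν i‖ ^ 2 := by
      rw [Finset.mul_sum]
      refine Finset.sum_le_sum fun j _ => ?_
      rw [← mul_pow]
      exact pow_le_pow_left₀ (norm_nonneg _) (hlipM j _ _) 2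
    refine h1.trans ?_
    gcongr
    linarith
  have hG : ∀ ν, 4 * Lmx ^ 2 * perp (x (ν + 1)) + 2 * perp (y (ν + 1)) ≤
      5 * ρ ^ 2 * (4 * Lmx ^ 2 * perp (x ν) + 2 * perp (y ν))
        + 14 * Lmx ^ 2 * ρ ^ 2 * ∑ i, ‖xh ν i - x ν i‖ ^ 2 := by
    intro ν
    have a1 := hX1 ν
    have a2 := hQ ν
    have a3 := hY1 ν
    have hXn := perp_nonneg (x ν)
    have hDn : 0 ≤ ∑ i, ‖xh ν i - x ν i‖ ^ 2 := Finset.sum_nonneg fun _ _ => by positivity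
    generalize perp (x (ν + 1)) = X' at *
    generalize perp (x ν) = X at *
    generalize perp (y (ν + 1)) = Y' at *
    generalize perp (y ν) = Y at *
    generalize ∑ i, ‖xh ν i - x ν i‖ ^ 2 = D at *
    generalize ∑ i, ‖x (ν + 1) i - x ν i‖ ^ 2 = Q at *
    have b1 : X' ≤ 2 / 5 * (X + D) := by nlinarith
    have b2 : Q ≤ 14 / 5 * X + 9 / 5 * D := by linarith
    have b3 : Lmx ^ 2 * X' ≤ Lmx ^ 2 * (ρ ^ 2 * (2 * X + 2 * D)) := by gcongr
    have b4 : ρ ^ 2 * (5 * Y + 5 / 4 * (Lmx ^ 2 * Q)) ≤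
        ρ ^ 2 * (5 * Y + 5 / 4 * (Lmx ^ 2 * (14 / 5 * X + 9 / 5 * D))) := by gcongr
    have b5 : 0 ≤ Lmx ^ 2 * ρ ^ 2 * X := by positivity
    have b6 : 0 ≤ Lmx ^ 2 * ρ ^ 2 * D := by positivity
    nlinarith
  obtain ⟨b, hb⟩ := hbdd
  obtain ⟨tX, tY, tD, l, tU, tUh⟩ := lyap_conv (fun ν => ∑ i, u (x ν i))
    (fun ν => ∑ i, u (xh ν i)) (fun ν => perp (x ν)) (fun ν => perp (y ν))
    (fun ν => ∑ i, ‖xh ν i - x ν i‖ ^ 2) (m * b) _ _ _ (γ * (4 * Lmx ^ 2)) (γ * 2)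
    (1 / (2 * ξ) / γ) (L + L * α ^ 2) ca cb cc
    (fun n => perp_nonneg _) (fun n => perp_nonneg _)
    (fun n => Finset.sum_nonneg fun _ _ => by positivity) (by positivity) (by positivity)
    (fun n => by
      calc (m : ℝ) * b = ∑ _i : Fin m, b := by simp
        _ ≤ _ := Finset.sum_le_sum fun i _ => hb _)
    (fun n => by
      have a1 := hhalf n
      have a2 := hmix n
      have a3 := mul_le_mul_of_nonneg_left (hG n) hγpos.le
      simp only [hβ]
      linarith)
    (fun n => by
      have a1 := hhalf n
      have hDn : 0 ≤ ∑ i, ‖xh n i - x n i‖ ^ 2 := Finset.sum_nonneg fun _ _ => by positivity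
      have hc : 0 ≤ 1 / α - L / 2 - ξ / 2 := by
        have : 0 ≤ 14 * Lmx ^ 2 * γ * ρ ^ 2 := by positivity
        linarith
      have a2 := mul_nonneg hc hDn
      have e : 1 / (2 * ξ) / γ * (γ * (4 * Lmx ^ 2) * perp (x n) + γ * 2 * perp (y n)) =
          1 / (2 * ξ) * (4 * Lmx ^ 2 * perp (x n) + 2 * perp (y n)) := by
        field_simp
      simp only [e]
      linarith)
    (fun n => by
      have a1 := hmix n
      have a2 : 0 ≤ L * perp (y n) := mul_nonneg hL0 (perp_nonneg _)
      have a3 : 0 ≤ L * α ^ 2 * perp (x n) := mul_nonneg (by positivity) (perp_nonneg _)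
      linarith)
    (by positivity)
  have sq : ∀ Z : ℕ → ℝ, Tendsto Z atTop (𝓝 0) →
      Tendsto (fun n => Real.sqrt (Z n)) atTop (𝓝 0) := fun Z hZ => by
    have := (Real.continuous_sqrt.tendsto 0).comp hZ
    rw [Real.sqrt_zero] at this
    exact this
  refine ⟨sq _ tD, sq _ tX, sq _ tY, ?_, l, tU, tUh⟩
  rw [hgrad]
  refine squeeze_zero (fun n => Finset.sum_nonneg fun _ _ => by positivity) herr ?_
  simpa using (tX.const_mul (4 * Lmx ^ 2)).add (tY.const_mul 2)
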